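/- Let T be a locally finite leafless ℝ-tree with at least three ends, and let G be a group of isometries of T whose induced action on ∂∞T is two-transitive (transitive on ordered pairs of distinct ends). Assume moreover that ∂∞T is infinite. Then a subgroup H of G is bounded if and only if there exists a subgroup K of G with H ≤ K such that every element of K is elliptic and no end of T is fixed by every element of K. -/

import Mathlib

/-- `s` is a geodesic segment joining `x` to `y`: the image of an isometric embedding of a
compact real interval, with endpoints `x` and `y`. -/
def IsGeodesicSegmentBetween {X : Type*} [MetricSpace X] (s : Set X) (x y : X) : Prop :=
  ∃ (γ : ℝ → X) (b : ℝ), 0 ≤ b ∧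
    (∀ u ∈ Set.Icc (0 : ℝ) b, ∀ v ∈ Set.Icc (0 : ℝ) b, dist (γ u) (γ v) = |u - v|) ∧
    γ 0 = x ∧ γ b = y ∧ s = γ '' Set.Icc 0 b

/-- `s` is a geodesic segment. -/
def IsGeodesicSegment {X : Type*} [MetricSpace X] (s : Set X) : Prop :=
  ∃ x y : X, IsGeodesicSegmentBetween s x y

/-- An ℝ-tree: any two points are joined by a unique geodesic segment, and if two geodesic
segments meet exactly in a common endpoint then their union is a geodesic segment. -/
def IsRTree (X : Type*) [MetricSpace X] : Prop :=
  (∀ x y : X, ∃! s : Set X, IsGeodesicSegmentBetween s x y) ∧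
  (∀ (s t : Set X) (x y z : X), IsGeodesicSegmentBetween s x y →
    IsGeodesicSegmentBetween t y z → s ∩ t = {y} → IsGeodesicSegmentBetween (s ∪ t) x z)

/-- `X` is leafless: every geodesic segment is contained in a strictly larger geodesic segment
extending it beyond each endpoint. -/
def Leafless (X : Type*) [MetricSpace X] : Prop :=
  ∀ (x y : X) (s : Set X), IsGeodesicSegmentBetween s x y →
    ∃ (x' y' : X) (s' : Set X), IsGeodesicSegmentBetween s' x' y' ∧ s ⊆ s' ∧
      0 < dist x' x ∧ 0 < dist y y' ∧ dist x' y' = dist x' x + dist x y + dist y y'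

/-- A ray: the image of an isometric embedding of `[0, ∞)`. -/
def IsRay {X : Type*} [MetricSpace X] (R : Set X) : Prop :=
  ∃ γ : ℝ → X, (∀ u ∈ Set.Ici (0 : ℝ), ∀ v ∈ Set.Ici (0 : ℝ), dist (γ u) (γ v) = |u - v|) ∧
    R = γ '' Set.Ici 0

/-- A ray starting at the point `x`. -/
def IsRayFrom {X : Type*} [MetricSpace X] (x : X) (R : Set X) : Prop :=
  ∃ γ : ℝ → X, (∀ u ∈ Set.Ici (0 : ℝ), ∀ v ∈ Set.Ici (0 : ℝ), dist (γ u) (γ v) = |u - v|) ∧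
    γ 0 = x ∧ R = γ '' Set.Ici 0

/-- An end of `X`, regarded as the set of all rays equivalent to a given ray (two rays are
equivalent when their intersection is a ray). -/
def IsEnd {X : Type*} [MetricSpace X] (e : Set (Set X)) : Prop :=
  ∃ R : Set X, IsRay R ∧ e = {R' : Set X | IsRay R' ∧ IsRay (R' ∩ R)}

/-- The action of a map on ends (as sets of rays), by pushing every ray forward. -/
def pushEnd {X Y : Type*} (φ : X → Y) (e : Set (Set X)) : Set (Set Y) :=
  (Set.image φ) '' e

/-- Two rays starting at `x` locally coincide: their intersection contains more than `x`. -/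
def LocCoincide {X : Type*} [MetricSpace X] (x : X) (R R' : Set X) : Prop :=
  ∃ p, p ∈ R ∩ R' ∧ p ≠ x

/-- `x` is a branch point: the valency of `x` (number of directions at `x`, i.e. classes of
rays from `x` up to local coincidence) is at least `3`. -/
def IsBranchPoint {X : Type*} [MetricSpace X] (x : X) : Prop :=
  ∃ R₁ R₂ R₃ : Set X, IsRayFrom x R₁ ∧ IsRayFrom x R₂ ∧ IsRayFrom x R₃ ∧
    ¬ LocCoincide x R₁ R₂ ∧ ¬ LocCoincide x R₁ R₃ ∧ ¬ LocCoincide x R₂ R₃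

/-- `X` is locally finite: every point has finite valency, i.e. finitely many directions. -/
def LocallyFiniteTree (X : Type*) [MetricSpace X] : Prop :=
  ∀ x : X, ∃ (n : ℕ) (Rs : Fin n → Set X), (∀ i, IsRayFrom x (Rs i)) ∧
    ∀ R : Set X, IsRayFrom x R → ∃ i, LocCoincide x R (Rs i)

/-- `X` admits at least three ends. -/
def AtLeastThreeEnds (X : Type*) [MetricSpace X] : Prop :=
  ∃ e₁ e₂ e₃ : Set (Set X), IsEnd e₁ ∧ IsEnd e₂ ∧ IsEnd e₃ ∧ e₁ ≠ e₂ ∧ e₁ ≠ e₃ ∧ e₂ ≠ e₃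

/-- `fbar : X → Y` induces the map `f` on ends: every ray lying in an end `e` is sent to a
ray lying in the end `f e`. -/
def Induces {X Y : Type*} [MetricSpace X] [MetricSpace Y]
    (fbar : X → Y) (f : Set (Set X) → Set (Set Y)) : Prop :=
  ∀ e : Set (Set X), IsEnd e → ∀ R ∈ e, fbar '' R ∈ f e

/-- A subgroup of isometries is bounded if some (equivalently, every) orbit has bounded
diameter. -/
def BoundedSubgroup {X : Type*} [MetricSpace X] (H : Subgroup (X ≃ᵢ X)) : Prop :=
  ∃ (x : X) (C : ℝ), ∀ h ∈ H, dist (h x) x ≤ C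

section RTree

variable {X : Type*}

/-- Two parametrized rays which eventually agree, up to a shift of the parameter. -/
def Asymptotic (γ δ : ℝ → X) : Prop :=
  ∃ a b : ℝ, 0 ≤ a ∧ 0 ≤ b ∧ ∀ t, 0 ≤ t → γ (a + t) = δ (b + t)

theorem Asymptotic.symm {γ δ : ℝ → X} (h : Asymptotic γ δ) : Asymptotic δ γ := by
  obtain ⟨a, b, ha, hb, h⟩ := h
  exact ⟨b, a, hb, ha, fun t ht => (h t ht).symm⟩

theorem Asymptotic.trans {γ δ ε : ℝ → X} (h : Asymptotic γ δ) (h' : Asymptotic δ ε) :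
    Asymptotic γ ε := by
  obtain ⟨a, b, ha, hb, h⟩ := h
  obtain ⟨c, d, hc, hd, h'⟩ := h'
  have h1 := le_max_left b c
  have h2 := le_max_right b c
  refine ⟨a + (max b c - b), d + (max b c - c), by linarith, by linarith, fun t ht => ?_⟩
  have e1 := h (max b c - b + t) (by linarith)
  have e2 := h' (max b c - c + t) (by linarith)
  rw [add_assoc, e1, add_assoc, ← e2]
  congr 1; ring

variable [MetricSpace X]

/-- Gromov's four point condition with constant zero. -/
def FourPoint (X : Type*) [MetricSpace X] : Prop :=
  ∀ x y z w : X, dist x y + dist z w ≤ max (dist x z + dist y w) (dist x w + dist y z)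

/-- Any two points are joined by a geodesic, in a pointwise formulation. -/
def GeodesicPoints (X : Type*) [MetricSpace X] : Prop :=
  ∀ (x y : X) (t : ℝ), 0 ≤ t → t ≤ dist x y →
    ∃ z : X, dist x z = t ∧ dist z y = dist x y - t

/-- A map which is isometric on `[0, ∞)`. -/
def RayMap (γ : ℝ → X) : Prop :=
  ∀ u ∈ Set.Ici (0 : ℝ), ∀ v ∈ Set.Ici (0 : ℝ), dist (γ u) (γ v) = |u - v|

/-- The end represented by a parametrized ray. -/
def endOf (γ : ℝ → X) : Set (Set X) :=
  {R' : Set X | IsRay R' ∧ IsRay (R' ∩ γ '' Set.Ici 0)}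

theorem IsRTree.geodesicPoints (hX : IsRTree X) : GeodesicPoints X := by
  intro x y t h0 ht
  obtain ⟨s, ⟨γ, b, hb, hγ, rfl, rfl, -⟩, -⟩ := hX.1 x y
  have hd : dist (γ 0) (γ b) = b := by
    rw [hγ 0 ⟨le_rfl, hb⟩ b ⟨hb, le_rfl⟩, zero_sub, abs_neg, abs_of_nonneg hb]
  rw [hd] at ht
  refine ⟨γ t, ?_, ?_⟩
  · rw [hγ 0 ⟨le_rfl, hb⟩ t ⟨h0, ht⟩, zero_sub, abs_neg, abs_of_nonneg h0]
  · rw [hγ t ⟨h0, ht⟩ b ⟨hb, le_rfl⟩, hd, abs_sub_comm, abs_of_nonneg (by linarith)]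

theorem IsGeodesicSegmentBetween.dist_add_dist {s : Set X} {x y z : X}
    (hs : IsGeodesicSegmentBetween s x y) (hz : z ∈ s) : dist x z + dist z y = dist x y := by
  obtain ⟨γ, b, hb, hγ, rfl, rfl, rfl⟩ := hs
  obtain ⟨t, ht, rfl⟩ := hz
  rw [hγ 0 ⟨le_rfl, hb⟩ t ht, hγ t ht b ⟨hb, le_rfl⟩, hγ 0 ⟨le_rfl, hb⟩ b ⟨hb, le_rfl⟩,
    abs_of_nonpos (by linarith [ht.1]), abs_of_nonpos (by linarith [ht.2]),
    abs_of_nonpos (by linarith)]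
  ring

theorem IsRTree.exists_median (hX : IsRTree X) (x y z : X) :
    ∃ m, dist x m + dist m y = dist x y ∧ dist x m + dist m z = dist x z ∧
      dist y m + dist m z = dist y z := by
  obtain ⟨-, ⟨γ, b, hb, hγ, hγ0, hγb, -⟩, -⟩ := hX.1 y x
  obtain ⟨-, ⟨δ, b', hb', hδ, hδ0, hδb, -⟩, -⟩ := hX.1 y z
  let A : Set ℝ := {t | 0 ≤ t ∧ t ≤ b ∧ t ≤ b' ∧ γ t = δ t}
  have h0A : (0 : ℝ) ∈ A := ⟨le_rfl, hb, hb', hγ0.trans hδ0.symm⟩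
  have hbdd : BddAbove A := ⟨b, fun t ht => ht.2.1⟩
  set T := sSup A with hT
  have hT0 : 0 ≤ T := le_csSup hbdd h0A
  have hTb : T ≤ b := csSup_le ⟨0, h0A⟩ fun t ht => ht.2.1
  have hTb' : T ≤ b' := csSup_le ⟨0, h0A⟩ fun t ht => ht.2.2.1
  have hTeq : γ T = δ T := by
    refine eq_of_forall_dist_le fun ε hε => ?_
    obtain ⟨t, htA, ht⟩ := exists_lt_of_lt_csSup ⟨0, h0A⟩ (show T - ε / 2 < sSup A by linarith)
    have htT : t ≤ T := le_csSup hbdd htA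
    have h1 := hγ T ⟨hT0, hTb⟩ t ⟨htA.1, htA.2.1⟩
    have h2 := hδ t ⟨htA.1, htA.2.2.1⟩ T ⟨hT0, hTb'⟩
    rw [abs_of_nonneg (by linarith)] at h1
    rw [abs_of_nonpos (by linarith)] at h2
    have h3 := dist_triangle (γ T) (γ t) (δ T)
    rw [htA.2.2.2] at h1 h3
    linarith
  have hs : IsGeodesicSegmentBetween (γ '' Set.Icc T b) x (γ T) := by
    refine ⟨fun u => γ (b - u), b - T, by linarith, ?_, by simpa using hγb, by simp, ?_⟩
    · rintro u ⟨hu, hu'⟩ v ⟨hv, hv'⟩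
      rw [hγ _ ⟨by linarith, by linarith⟩ _ ⟨by linarith, by linarith⟩, abs_sub_comm]
      congr 1; ring
    · ext w; constructor
      · rintro ⟨u, ⟨hu, hu'⟩, rfl⟩
        exact ⟨b - u, ⟨by linarith, by linarith⟩, by simp⟩
      · rintro ⟨u, ⟨hu, hu'⟩, rfl⟩
        exact ⟨b - u, ⟨by linarith, by linarith⟩, rfl⟩
  have ht : IsGeodesicSegmentBetween (δ '' Set.Icc T b') (γ T) z := by
    refine ⟨fun u => δ (T + u), b' - T, by linarith, ?_, by simp [hTeq], by simpa using hδb, ?_⟩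
    · rintro u ⟨hu, hu'⟩ v ⟨hv, hv'⟩
      rw [hδ _ ⟨by linarith, by linarith⟩ _ ⟨by linarith, by linarith⟩]
      congr 1; ring
    · ext w; constructor
      · rintro ⟨u, ⟨hu, hu'⟩, rfl⟩
        exact ⟨u - T, ⟨by linarith, by linarith⟩, by simp⟩
      · rintro ⟨u, ⟨hu, hu'⟩, rfl⟩
        exact ⟨T + u, ⟨by linarith, by linarith⟩, rfl⟩
  have hst : γ '' Set.Icc T b ∩ δ '' Set.Icc T b' = {γ T} := by
    refine Set.Subset.antisymm ?_ ?_
    · rintro w ⟨⟨u, ⟨hu, hu'⟩, rfl⟩, ⟨v, ⟨hv, hv'⟩, hvu⟩⟩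
      have h1 := hγ 0 ⟨le_rfl, hb⟩ u ⟨by linarith, hu'⟩
      have h2 := hδ 0 ⟨le_rfl, hb'⟩ v ⟨by linarith, hv'⟩
      rw [hδ0, hvu, ← hγ0, h1, abs_of_nonpos (by linarith), abs_of_nonpos (by linarith)] at h2
      have huv : u = v := by linarith
      subst huv
      have : u ≤ T := le_csSup hbdd ⟨by linarith, hu', hv', hvu.symm⟩
      rw [Set.mem_singleton_iff, le_antisymm this hu]
    · rintro w rfl
      exact ⟨⟨T, ⟨le_rfl, hTb⟩, rfl⟩, ⟨T, ⟨le_rfl, hTb'⟩, hTeq.symm⟩⟩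
  have hd := (hX.2 _ _ _ _ _ hs ht hst).dist_add_dist (Or.inl ⟨T, ⟨le_rfl, hTb⟩, rfl⟩)
  refine ⟨γ T, ?_, hd, ?_⟩
  · rw [← hγ0, ← hγb, hγ b ⟨hb, le_rfl⟩ T ⟨hT0, hTb⟩, hγ T ⟨hT0, hTb⟩ 0 ⟨le_rfl, hb⟩,
      hγ b ⟨hb, le_rfl⟩ 0 ⟨le_rfl, hb⟩, abs_of_nonneg (by linarith), abs_of_nonneg (by linarith),
      abs_of_nonneg (by linarith)]
    ring
  · rw [hTeq, ← hδ0, ← hδb, hδ 0 ⟨le_rfl, hb'⟩ T ⟨hT0, hTb'⟩, hδ T ⟨hT0, hTb'⟩ b' ⟨hb', le_rfl⟩,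
      hδ 0 ⟨le_rfl, hb'⟩ b' ⟨hb', le_rfl⟩, abs_of_nonpos (by linarith),
      abs_of_nonpos (by linarith), abs_of_nonpos (by linarith)]
    ring

theorem IsRTree.mem_segment (hX : IsRTree X) {s : Set X} {x y z : X}
    (hs : IsGeodesicSegmentBetween s x y) (hz : dist x z + dist z y = dist x y) : z ∈ s := by
  obtain ⟨s₁, hs₁, -⟩ := hX.1 x z
  obtain ⟨s₂, hs₂, -⟩ := hX.1 z y
  have hz₁ : z ∈ s₁ := by
    obtain ⟨γ, b, hb, -, -, rfl, rfl⟩ := hs₁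
    exact ⟨b, ⟨hb, le_rfl⟩, rfl⟩
  have hz₂ : z ∈ s₂ := by
    obtain ⟨γ, b, hb, -, rfl, -, rfl⟩ := hs₂
    exact ⟨0, ⟨le_rfl, hb⟩, rfl⟩
  have hint : s₁ ∩ s₂ = {z} := by
    refine Set.Subset.antisymm (fun w hw => ?_) (Set.singleton_subset_iff.2 ⟨hz₁, hz₂⟩)
    have h1 := hs₁.dist_add_dist hw.1
    have h2 := hs₂.dist_add_dist hw.2
    have h3 := dist_triangle x w y
    have h4 := dist_comm z w
    exact dist_le_zero.1 (by linarith [dist_nonneg (x := w) (y := z)])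
  rw [(hX.1 x y).unique hs (hX.2 _ _ _ _ _ hs₁ hs₂ hint)]
  exact Or.inl hz₁

theorem IsRTree.dist_le_of_between (hX : IsRTree X) {x y m n : X}
    (hm : dist x m + dist m y = dist x y) (hn : dist x n + dist n y = dist x y)
    (hmn : dist x m ≤ dist x n) : dist m n ≤ dist x n - dist x m := by
  obtain ⟨s, hs, -⟩ := hX.1 x y
  have hms := hX.mem_segment hs hm
  have hns := hX.mem_segment hs hn
  obtain ⟨γ, b, hb, hγ, rfl, rfl, rfl⟩ := hs
  obtain ⟨u, hu, rfl⟩ := hms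
  obtain ⟨v, hv, rfl⟩ := hns
  have h0 : (0 : ℝ) ∈ Set.Icc 0 b := ⟨le_rfl, hb⟩
  have hu0 : 0 - u ≤ 0 := sub_nonpos.2 hu.1
  have hv0 : 0 - v ≤ 0 := sub_nonpos.2 hv.1
  rw [hγ _ h0 _ hu, hγ _ h0 _ hv, abs_of_nonpos hu0, abs_of_nonpos hv0] at hmn ⊢
  rw [hγ _ hu _ hv, abs_of_nonpos (by linarith)]
  linarith

theorem IsRTree.fourPoint (hX : IsRTree X) : FourPoint X := by
  intro x y z w
  obtain ⟨m, hm1, hm2, hm3⟩ := hX.exists_median x y z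
  obtain ⟨n, hn1, hn2, hn3⟩ := hX.exists_median x y w
  have t1 := dist_triangle4 z m n w
  have c1 := dist_comm z m
  have c2 := dist_comm m y
  have c3 := dist_comm n y
  have c4 := dist_comm n m
  rw [le_max_iff]
  rcases le_total (dist x m) (dist x n) with h | h
  · have := hX.dist_le_of_between hm1 hn1 h
    right; linarith
  · have := hX.dist_le_of_between hn1 hm1 h
    left; linarith

theorem FourPoint.eq_of_between (h4 : FourPoint X) {x y z z' : X}
    (h : dist x z + dist z y = dist x y) (h1 : dist x z = dist x z') (h2 : dist z y = dist z' y) :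
    z = z' := by
  have := h4 x y z z'
  have c1 := dist_comm y z
  have c2 := dist_comm y z'
  have : dist z z' ≤ 0 := by
    rcases le_max_iff.1 this with h | h <;> linarith
  exact dist_le_zero.1 this

theorem FourPoint.dist_eq_abs_of_between (h4 : FourPoint X) {ι : Type*} {p : ι → X} {c : ι → ℝ}
    (hp : ∀ i j, dist (p i) (p j) = |c i - c j|) {i j : ι} {z : X} {t : ℝ}
    (hi : c i ≤ t) (hj : t ≤ c j) (hzi : dist (p i) z = t - c i) (hzj : dist z (p j) = c j - t)
    (k : ι) : dist z (p k) = |t - c k| := by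
  have h := h4 (p i) (p j) (p k) z
  have hij := hp i j
  have hik := hp i k
  have hjk := hp j k
  rw [abs_of_nonpos (by linarith)] at hij
  have c1 := dist_comm z (p j)
  have c2 := dist_comm z (p k)
  have c3 := dist_comm z (p i)
  have t1 := dist_triangle z (p i) (p k)
  have t2 := dist_triangle z (p j) (p k)
  have t3 := dist_triangle (p i) z (p k)
  have t4 := dist_triangle (p j) z (p k)
  rcases le_total (c k) (c i) with h1 | h1
  · rw [abs_of_nonneg (by linarith)] at hik hjk ⊢
    linarith
  rcases le_total (c j) (c k) with h2 | h2
  · rw [abs_of_nonpos (by linarith)] at hik hjk ⊢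
    linarith
  rw [abs_of_nonpos (by linarith)] at hik
  rw [abs_of_nonneg (by linarith)] at hjk
  rcases le_max_iff.1 h with h | h <;>
  rcases abs_cases (t - c k) with ⟨h5, h6⟩ | ⟨h5, h6⟩ <;> rw [h5] <;> linarith

theorem FourPoint.exists_isometric_extension (h4 : FourPoint X) (hg : GeodesicPoints X)
    {ι : Type*} [Nonempty ι] {p : ι → X} {c : ι → ℝ}
    (hp : ∀ i j, dist (p i) (p j) = |c i - c j|) (I : Set ℝ) (hI : ∀ t ∈ I, ∃ i j, c i ≤ t ∧ t ≤ c j) :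
    ∃ γ : ℝ → X, (∀ u ∈ I, ∀ v ∈ I, dist (γ u) (γ v) = |u - v|) ∧
      ∀ i, c i ∈ I → γ (c i) = p i := by
  have key : ∀ t, ∃ z, t ∈ I → ∀ k, dist z (p k) = |t - c k| := by
    intro t
    by_cases ht : t ∈ I
    · obtain ⟨i, j, hi, hj⟩ := hI t ht
      have hij := hp i j
      rw [abs_of_nonpos (by linarith)] at hij
      obtain ⟨z, hz1, hz2⟩ := hg (p i) (p j) (t - c i) (by linarith) (by linarith)
      exact ⟨z, fun _ => h4.dist_eq_abs_of_between hp hi hj hz1 (by linarith)⟩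
    · exact ⟨p (Classical.arbitrary ι), fun h => absurd h ht⟩
  choose γ hγ using key
  refine ⟨γ, ?_, fun i hi => ?_⟩
  · have aux : ∀ u ∈ I, ∀ v ∈ I, u ≤ v → dist (γ u) (γ v) = |u - v| := by
      intro u hu v hv huv
      obtain ⟨i, -, hi, -⟩ := hI u hu
      obtain ⟨-, j, -, hj⟩ := hI v hv
      have h1 := hγ u hu i
      have h2 := hγ u hu j
      have h3 := hγ v hv i
      have h4' := hγ v hv j
      have hij := hp i j
      rw [abs_of_nonneg (by linarith)] at h1 h3
      rw [abs_of_nonpos (by linarith)] at h2 h4' hij ⊢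
      have c1 := dist_comm (p i) (γ u)
      have c2 := dist_comm (p i) (γ v)
      have c3 := dist_comm (p j) (γ u)
      have c4 := dist_comm (p j) (γ v)
      have t1 := dist_triangle4 (p i) (γ u) (γ v) (p j)
      rcases le_max_iff.1 (h4 (p i) (p j) (γ u) (γ v)) with h | h <;> linarith
    intro u hu v hv
    rcases le_total u v with h | h
    · exact aux u hu v hv h
    · rw [dist_comm, abs_sub_comm]; exact aux v hv u hu h
  · have := hγ (c i) hi i
    rwa [sub_self, abs_zero, dist_eq_zero] at this

theorem FourPoint.eq_of_eq_endpoints (h4 : FourPoint X) {γ δ : ℝ → X} {a b t : ℝ}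
    (hγ : ∀ u ∈ Set.Icc a b, ∀ v ∈ Set.Icc a b, dist (γ u) (γ v) = |u - v|)
    (hδ : ∀ u ∈ Set.Icc a b, ∀ v ∈ Set.Icc a b, dist (δ u) (δ v) = |u - v|)
    (h1 : γ a = δ a) (h2 : γ b = δ b) (ht : t ∈ Set.Icc a b) : γ t = δ t := by
  have ha : a ∈ Set.Icc a b := ⟨le_rfl, ht.1.trans ht.2⟩
  have hb : b ∈ Set.Icc a b := ⟨ht.1.trans ht.2, le_rfl⟩
  refine h4.eq_of_between (x := γ a) (y := γ b) ?_ ?_ ?_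
  · rw [hγ _ ha _ ht, hγ _ ht _ hb, hγ _ ha _ hb, abs_of_nonpos (by linarith [ht.1]),
      abs_of_nonpos (by linarith [ht.2]), abs_of_nonpos (by linarith [ha.2])]
    ring
  · rw [hγ _ ha _ ht, h1, hδ _ ha _ ht]
  · rw [hγ _ ht _ hb, h2, hδ _ ht _ hb]


theorem RayMap.comp {γ : ℝ → X} (hγ : RayMap γ) (g : X ≃ᵢ X) : RayMap (g ∘ γ) :=
  fun u hu v hv => (g.dist_eq _ _).trans (hγ u hu v hv)

theorem RayMap.shift {γ : ℝ → X} (hγ : RayMap γ) {a : ℝ} (ha : 0 ≤ a) :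
    RayMap fun t => γ (a + t) := fun u hu v hv => by
  rw [hγ _ (add_nonneg ha hu) _ (add_nonneg ha hv), add_sub_add_left_eq_sub]

theorem RayMap.mono {γ : ℝ → X} (hγ : RayMap γ) {a b : ℝ} (ha : 0 ≤ a) :
    ∀ u ∈ Set.Icc a b, ∀ v ∈ Set.Icc a b, dist (γ u) (γ v) = |u - v| :=
  fun u hu v hv => hγ u (ha.trans hu.1) v (ha.trans hv.1)

theorem RayMap.dist_of_le {γ : ℝ → X} (hγ : RayMap γ) {u v : ℝ} (hu : 0 ≤ u) (huv : u ≤ v) :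
    dist (γ u) (γ v) = v - u := by
  rw [hγ u hu v (hu.trans huv), abs_of_nonpos (by linarith)]
  ring

theorem RayMap.isRay {γ : ℝ → X} (hγ : RayMap γ) : IsRay (γ '' Set.Ici 0) := ⟨γ, hγ, rfl⟩

/-- An isometric self-map of `[0, ∞)` is a translation. -/
theorem eq_add_of_abs_sub_eq {f : ℝ → ℝ} (h0 : ∀ t, 0 ≤ t → 0 ≤ f t)
    (hf : ∀ s, 0 ≤ s → ∀ t, 0 ≤ t → |f s - f t| = |s - t|) {t : ℝ} (ht : 0 ≤ t) :
    f t = f 0 + t := by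
  have hf0 := h0 0 le_rfl
  have hs0 : 0 ≤ f 0 + 1 + t := by linarith
  have h1 := hf t ht 0 le_rfl
  have h2 := hf _ hs0 0 le_rfl
  have h3 := hf _ hs0 t ht
  have h4 := h0 _ hs0
  rw [sub_zero, abs_of_nonneg ht] at h1
  rw [sub_zero, abs_of_nonneg hs0] at h2
  rw [add_sub_cancel_right, abs_of_nonneg (show 0 ≤ f 0 + 1 by linarith)] at h3
  rcases abs_cases (f t - f 0) with ⟨e1, _⟩ | ⟨e1, _⟩ <;>
  rcases abs_cases (f (f 0 + 1 + t) - f 0) with ⟨e2, _⟩ | ⟨e2, _⟩ <;>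
  rcases abs_cases (f (f 0 + 1 + t) - f t) with ⟨e3, _⟩ | ⟨e3, _⟩ <;> linarith

theorem RayMap.asymptotic_of_image_subset {γ ε : ℝ → X} (hγ : RayMap γ) (hε : RayMap ε)
    (h : ε '' Set.Ici 0 ⊆ γ '' Set.Ici 0) : Asymptotic γ ε := by
  have h' : ∀ t : ℝ, ∃ u : ℝ, 0 ≤ t → 0 ≤ u ∧ γ u = ε t := by
    intro t
    by_cases ht : 0 ≤ t
    · obtain ⟨u, hu, hut⟩ := h ⟨t, ht, rfl⟩
      exact ⟨u, fun _ => ⟨hu, hut⟩⟩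
    · exact ⟨0, fun h => absurd h ht⟩
  choose f hf using h'
  refine ⟨f 0, 0, (hf 0 le_rfl).1, le_rfl, fun t ht => ?_⟩
  rw [← eq_add_of_abs_sub_eq (f := f) (fun t ht => (hf t ht).1) ?_ ht, (hf t ht).2, zero_add]
  intro s hs t ht
  rw [← hγ _ (hf s hs).1 _ (hf t ht).1, (hf s hs).2, (hf t ht).2, hε _ hs _ ht]

theorem RayMap.asymptotic_of_isRay_inter {γ δ : ℝ → X} (hγ : RayMap γ) (hδ : RayMap δ)
    (h : IsRay (γ '' Set.Ici 0 ∩ δ '' Set.Ici 0)) : Asymptotic γ δ := by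
  obtain ⟨ε, hε, he⟩ := h
  exact (hγ.asymptotic_of_image_subset hε (he ▸ Set.inter_subset_left)).trans
    (hδ.asymptotic_of_image_subset hε (he ▸ Set.inter_subset_right)).symm

theorem RayMap.isRay_inter_of_asymptotic (h4 : FourPoint X) {γ δ : ℝ → X} (hγ : RayMap γ)
    (hδ : RayMap δ) (h : Asymptotic γ δ) : IsRay (γ '' Set.Ici 0 ∩ δ '' Set.Ici 0) := by
  obtain ⟨a, b, ha, hb, hab⟩ := h
  let A : Set ℝ := {u | 0 ≤ u ∧ 0 ≤ u + (b - a) ∧ γ u = δ (u + (b - a))}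
  have haA : a ∈ A := ⟨ha, by linarith, by simpa using hab 0 le_rfl⟩
  have hbdd : BddBelow A := ⟨0, fun u hu => hu.1⟩
  set u₀ := sInf A
  have hu₀ : 0 ≤ u₀ := le_csInf ⟨a, haA⟩ fun u hu => hu.1
  have hu₁ : 0 ≤ u₀ + (b - a) := by
    have : -(b - a) ≤ u₀ := le_csInf ⟨a, haA⟩ fun u hu => by linarith [hu.2.1]
    linarith
  have heq : γ u₀ = δ (u₀ + (b - a)) := by
    refine eq_of_forall_dist_le fun ε hε => ?_
    obtain ⟨u, huA, hu⟩ := exists_lt_of_csInf_lt ⟨a, haA⟩ (show sInf A < u₀ + ε / 2 by linarith)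
    have hle : u₀ ≤ u := csInf_le hbdd huA
    have h1 := hγ.dist_of_le hu₀ hle
    have h2 := hδ.dist_of_le hu₁ (show _ ≤ u + (b - a) by linarith)
    have h3 := dist_triangle (γ u₀) (γ u) (δ (u₀ + (b - a)))
    have h5 := dist_comm (δ (u₀ + (b - a))) (δ (u + (b - a)))
    rw [huA.2.2] at h1 h3
    linarith
  have hfar : ∀ u, a ≤ u → γ u = δ (u + (b - a)) := by
    intro u hu
    have := hab (u - a) (by linarith)
    rw [add_sub_cancel] at this
    rw [this]; congr 1; ring
  have hall : ∀ u, u₀ ≤ u → γ u = δ (u + (b - a)) := by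
    intro u hu
    refine h4.eq_of_eq_endpoints (δ := fun u => δ (u + (b - a))) (a := u₀) (b := max a u)
      (hγ.mono hu₀) ?_ heq (hfar _ (le_max_left _ _)) ⟨hu, le_max_right _ _⟩
    intro s hs t ht
    have hs' := hs.1
    have ht' := ht.1
    change dist (δ (s + (b - a))) (δ (t + (b - a))) = _
    rw [hδ _ (show 0 ≤ s + (b - a) by linarith) _ (show 0 ≤ t + (b - a) by linarith),
      add_sub_add_right_eq_sub]
  refine ⟨fun t => γ (u₀ + t), hγ.shift hu₀, Set.Subset.antisymm ?_ ?_⟩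
  · rintro w ⟨⟨u, hu, rfl⟩, ⟨v, hv, hvu⟩⟩
    rw [Set.mem_Ici] at hu hv
    set M := max a (max u (v - (b - a)))
    have hM1 : a ≤ M := le_max_left _ _
    have hM2 : u ≤ M := (le_max_left _ _).trans (le_max_right _ _)
    have hM3 : v - (b - a) ≤ M := (le_max_right _ _).trans (le_max_right _ _)
    have h1 := hγ.dist_of_le hu hM2
    have h2 := hδ.dist_of_le hv (show v ≤ M + (b - a) by linarith)
    rw [hfar M hM1, ← hvu, h2] at h1
    have hv' : v = u + (b - a) := by linarith
    have huA : u ∈ A := ⟨hu, hv' ▸ hv, by rw [← hvu, hv']⟩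
    exact ⟨u - u₀, sub_nonneg.2 (csInf_le hbdd huA), by simp⟩
  · rintro w ⟨t, ht, rfl⟩
    rw [Set.mem_Ici] at ht
    exact ⟨⟨u₀ + t, add_nonneg hu₀ ht, rfl⟩,
      ⟨u₀ + t + (b - a), show (0 : ℝ) ≤ u₀ + t + (b - a) by linarith, (hall _ (by linarith)).symm⟩⟩

theorem RayMap.endOf_eq_iff (h4 : FourPoint X) {γ δ : ℝ → X} (hγ : RayMap γ) (hδ : RayMap δ) :
    endOf γ = endOf δ ↔ Asymptotic γ δ := by
  constructor
  · intro h
    have : γ '' Set.Ici 0 ∈ endOf γ := ⟨hγ.isRay, by rw [Set.inter_self]; exact hγ.isRay⟩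
    rw [h] at this
    exact hγ.asymptotic_of_isRay_inter hδ this.2
  · intro h
    ext R
    constructor
    · rintro ⟨⟨ε, hε, rfl⟩, hR⟩
      exact ⟨⟨ε, hε, rfl⟩, RayMap.isRay_inter_of_asymptotic h4 hε hδ
        ((RayMap.asymptotic_of_isRay_inter hε hγ hR).trans h)⟩
    · rintro ⟨⟨ε, hε, rfl⟩, hR⟩
      exact ⟨⟨ε, hε, rfl⟩, RayMap.isRay_inter_of_asymptotic h4 hε hγ
        ((RayMap.asymptotic_of_isRay_inter hε hδ hR).trans h.symm)⟩

theorem RayMap.isEnd {γ : ℝ → X} (hγ : RayMap γ) : IsEnd (endOf γ) := ⟨_, hγ.isRay, rfl⟩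

theorem IsEnd.exists_rayMap {e : Set (Set X)} (he : IsEnd e) :
    ∃ γ : ℝ → X, RayMap γ ∧ endOf γ = e := by
  obtain ⟨-, ⟨γ, hγ, rfl⟩, rfl⟩ := he
  exact ⟨γ, hγ, rfl⟩

theorem IsRay.image {R : Set X} (hR : IsRay R) (g : X ≃ᵢ X) : IsRay (g '' R) := by
  obtain ⟨γ, hγ, rfl⟩ := hR
  exact ⟨g ∘ γ, RayMap.comp hγ g, by rw [Set.image_comp]⟩

theorem pushEnd_endOf (g : X ≃ᵢ X) (γ : ℝ → X) : pushEnd g (endOf γ) = endOf (g ∘ γ) := by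
  ext R
  constructor
  · rintro ⟨R, ⟨hR, hR'⟩, rfl⟩
    refine ⟨hR.image g, ?_⟩
    rw [Set.image_comp, ← Set.image_inter g.injective]
    exact hR'.image g
  · rintro ⟨hR, hR'⟩
    have hgg : ∀ S : Set X, g.symm '' (g '' S) = S := fun S => by simp [Set.image_image]
    refine ⟨g.symm '' R, ⟨hR.image _, ?_⟩, by simp [Set.image_image]⟩
    have := hR'.image g.symm
    rwa [Set.image_comp, Set.image_inter g.symm.injective, hgg] at this

theorem RayMap.pushEnd_endOf_eq_iff (h4 : FourPoint X) {γ δ : ℝ → X} (hγ : RayMap γ)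
    (hδ : RayMap δ) (g : X ≃ᵢ X) : pushEnd g (endOf γ) = endOf δ ↔ Asymptotic (g ∘ γ) δ := by
  rw [pushEnd_endOf, RayMap.endOf_eq_iff h4 (hγ.comp g) hδ]

theorem RayMap.dist_apply_eq (h4 : FourPoint X) {γ : ℝ → X} (hγ : RayMap γ) (x : X) {t : ℝ}
    (ht : dist x (γ 0) ≤ t) :
    dist x (γ t) = dist x (γ (dist x (γ 0))) + t - dist x (γ 0) := by
  set D := dist x (γ 0) with hD
  have hD0 : 0 ≤ D := dist_nonneg
  have h1 := hγ.dist_of_le le_rfl (hD0.trans ht)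
  have h2 := hγ.dist_of_le le_rfl hD0
  have h3 := hγ.dist_of_le hD0 ht
  have t1 := dist_triangle x (γ D) (γ t)
  rcases le_max_iff.1 (h4 x (γ D) (γ 0) (γ t)) with h | h
  · have h0 : dist x (γ D) = 0 := by
      have := dist_comm (γ D) (γ t)
      linarith [dist_nonneg (x := x) (y := γ D)]
    have := dist_eq_zero.1 h0
    rw [h0, this, h3]; ring
  · have := dist_comm (γ D) (γ 0)
    linarith

theorem RayMap.exists_asymptotic_from (h4 : FourPoint X) (hg : GeodesicPoints X) {γ : ℝ → X}
    (hγ : RayMap γ) (x : X) : ∃ δ : ℝ → X, RayMap δ ∧ δ 0 = x ∧ Asymptotic δ γ := by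
  set D := dist x (γ 0) with hD
  set E := dist x (γ D) with hE
  have hD0 : 0 ≤ D := dist_nonneg
  have hE0 : 0 ≤ E := dist_nonneg
  have hd : ∀ t, D ≤ t → dist x (γ t) = E + t - D := fun t ht => hγ.dist_apply_eq h4 x ht
  let p : ℝ → X := fun t => if D ≤ t then γ t else x
  let c : ℝ → ℝ := fun t => if D ≤ t then E + t - D else 0
  have hp : ∀ i j, dist (p i) (p j) = |c i - c j| := by
    intro i j
    by_cases hi : D ≤ i <;> by_cases hj : D ≤ j <;> simp only [p, c, hi, hj, if_true, if_false]
    · rw [hγ _ (hD0.trans hi) _ (hD0.trans hj)]; congr 1; ring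
    · rw [dist_comm, hd _ hi, abs_of_nonneg (by linarith)]; ring
    · rw [hd _ hj, abs_of_nonpos (by linarith)]; ring
    · simp
  have hneg : ¬ D ≤ D - 1 := by linarith
  obtain ⟨δ, hδ, hδp⟩ := h4.exists_isometric_extension hg hp (Set.Ici 0) (fun t ht => by
    refine ⟨D - 1, D + t, ?_, ?_⟩
    · simpa only [c, hneg, if_false] using show 0 ≤ t from ht
    · simp only [c, le_add_iff_nonneg_right, show 0 ≤ t from ht, if_true]; linarith)
  refine ⟨δ, hδ, ?_, E, D, hE0, hD0, fun t ht => ?_⟩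
  · simpa only [c, p, hneg, if_false, Set.mem_Ici, le_refl, forall_true_left] using hδp (D - 1)
  · have h1 := hδp (D + t)
    simp only [c, p, le_add_iff_nonneg_right, ht, if_true, Set.mem_Ici] at h1
    rw [← h1 (by linarith)]
    congr 1; ring

theorem RayMap.eq_of_asymptotic (h4 : FourPoint X) {γ δ : ℝ → X} (hγ : RayMap γ) (hδ : RayMap δ)
    (h0 : γ 0 = δ 0) (h : Asymptotic γ δ) {t : ℝ} (ht : 0 ≤ t) : γ t = δ t := by
  obtain ⟨a, b, ha, hb, hab⟩ := h
  have h1 := hγ.dist_of_le le_rfl (show 0 ≤ a + t by linarith)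
  have h2 := hδ.dist_of_le le_rfl (show 0 ≤ b + t by linarith)
  rw [h0, hab t ht, h2] at h1
  obtain rfl : a = b := by linarith
  exact h4.eq_of_eq_endpoints (hγ.mono le_rfl) (hδ.mono le_rfl) h0 (hab t ht)
    ⟨ht, by linarith⟩

/-- Two rays from the same point which are not asymptotic diverge at some time. -/
theorem RayMap.exists_divergence (h4 : FourPoint X) {γ δ : ℝ → X} (hγ : RayMap γ)
    (hδ : RayMap δ) (h0 : γ 0 = δ 0) (h : ¬ Asymptotic γ δ) :
    ∃ T, 0 ≤ T ∧ γ T = δ T ∧ ∀ u v, T ≤ u → T ≤ v → dist (γ u) (δ v) = u + v - 2 * T := by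
  let A : Set ℝ := {t | 0 ≤ t ∧ γ t = δ t}
  have hA : ∀ t ∈ A, ∀ s, 0 ≤ s → s ≤ t → γ s = δ s := fun t ht s hs hst =>
    h4.eq_of_eq_endpoints (hγ.mono le_rfl) (hδ.mono le_rfl) h0 ht.2 ⟨hs, hst⟩
  have h0A : (0 : ℝ) ∈ A := ⟨le_rfl, h0⟩
  have hbdd : BddAbove A := by
    by_contra hb
    rw [not_bddAbove_iff] at hb
    refine h ⟨0, 0, le_rfl, le_rfl, fun t ht => ?_⟩
    obtain ⟨s, hs, hts⟩ := hb t
    rw [zero_add]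
    exact hA s hs t ht hts.le
  set T := sSup A
  have hT0 : 0 ≤ T := le_csSup hbdd h0A
  have hTeq : γ T = δ T := by
    refine eq_of_forall_dist_le fun ε hε => ?_
    obtain ⟨t, htA, ht⟩ := exists_lt_of_lt_csSup ⟨0, h0A⟩ (show T - ε / 2 < sSup A by linarith)
    have htT : t ≤ T := le_csSup hbdd htA
    have h1 := hγ.dist_of_le htA.1 htT
    have h2 := hδ.dist_of_le htA.1 htT
    have h3 := dist_triangle_left (γ T) (δ T) (γ t)
    rw [htA.2] at h1 h3
    linarith
  refine ⟨T, hT0, hTeq, fun u v hu hv => ?_⟩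
  have d1 := hγ.dist_of_le hT0 hu
  have d2 := hδ.dist_of_le hT0 hv
  have d3 := hγ.dist_of_le le_rfl (hT0.trans hu)
  have d4 := hδ.dist_of_le le_rfl (hT0.trans hv)
  have t1 := dist_triangle (γ u) (γ T) (δ v)
  have t2 := dist_triangle (γ 0) (γ u) (δ v)
  have t3 := dist_triangle (γ 0) (δ v) (γ u)
  rw [dist_comm (γ u) (γ T), hTeq] at t1
  rw [hTeq] at d1
  rw [h0] at d3 t2 t3
  rw [dist_comm (δ v) (γ u)] at t3
  set r := (u + v - dist (γ u) (δ v)) / 2 with hr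
  have hrT : T ≤ r := by linarith
  have hru : r ≤ u := by linarith
  have hrv : r ≤ v := by linarith
  have e1 := hγ.dist_of_le (hT0.trans hrT) hru
  have e2 := hδ.dist_of_le (hT0.trans hrT) hrv
  have e3 := hγ.dist_of_le le_rfl (hT0.trans hrT)
  have e4 := hδ.dist_of_le le_rfl (hT0.trans hrT)
  rw [h0] at e3
  have hrr : γ r = δ r := by
    have f1 : dist (γ u) (δ r) = u - r := by
      have s1 := dist_triangle (γ u) (δ r) (δ v)
      have s2 := h4 (γ u) (δ r) (δ 0) (δ v)
      have s3 := dist_comm (γ u) (δ 0)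
      have s4 := dist_comm (δ r) (δ 0)
      have s5 := dist_triangle (δ 0) (δ r) (γ u)
      have s6 := dist_comm (γ u) (δ r)
      rcases le_max_iff.1 s2 with s | s <;> linarith
    refine h4.eq_of_between (x := δ 0) (y := γ u) ?_ ?_ ?_
    · linarith
    · linarith
    · rw [dist_comm (δ r), e1, f1]
  have : r ≤ T := le_csSup hbdd ⟨hT0.trans hrT, hrr⟩
  linarith

theorem isometry_glue {γ δ : ℝ → X} (hγ : RayMap γ) (hδ : RayMap δ)
    (h : ∀ u v, 0 ≤ u → 0 ≤ v → dist (γ u) (δ v) = u + v) :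
    Isometry fun t : ℝ => if 0 ≤ t then γ t else δ (-t) := by
  refine Isometry.of_dist_eq fun s t => ?_
  rw [Real.dist_eq]
  by_cases hs : 0 ≤ s <;> by_cases ht : 0 ≤ t <;> simp only [hs, ht, if_true, if_false]
  · exact hγ s hs t ht
  · rw [h _ _ hs (by linarith), abs_of_nonneg (by linarith)]; ring
  · rw [dist_comm, h _ _ ht (by linarith), abs_of_nonpos (by linarith)]; ring
  · rw [hδ _ (show 0 ≤ -s by linarith) _ (show 0 ≤ -t by linarith), abs_sub_comm]
    congr 1; ring

theorem Isometry.rayMap {γ : ℝ → X} (hγ : Isometry γ) : RayMap γ :=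
  fun u _ v _ => (hγ.dist_eq u v).trans (Real.dist_eq u v)

theorem Isometry.comp_neg_real {γ : ℝ → X} (hγ : Isometry γ) : Isometry fun t => γ (-t) :=
  hγ.comp (IsometryEquiv.neg ℝ).isometry

theorem Isometry.comp_add_real {γ : ℝ → X} (hγ : Isometry γ) (c : ℝ) :
    Isometry fun t => γ (t + c) :=
  hγ.comp (IsometryEquiv.addRight c).isometry

theorem Isometry.dist_line {γ : ℝ → X} (hγ : Isometry γ) (u v : ℝ) :
    dist (γ u) (γ v) = |u - v| := (hγ.dist_eq u v).trans (Real.dist_eq u v)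

theorem Isometry.not_asymptotic_neg {γ : ℝ → X} (hγ : Isometry γ) :
    ¬ Asymptotic γ fun t => γ (-t) := by
  rintro ⟨a, b, ha, hb, h⟩
  have := hγ.injective (h 1 zero_le_one)
  linarith

theorem Isometry.eq_shift_of_asymptotic (h4 : FourPoint X) {γ η : ℝ → X} (hγ : Isometry γ)
    (hη : Isometry η) (h1 : Asymptotic γ η)
    (h2 : Asymptotic (fun t => γ (-t)) fun t => η (-t)) : ∃ c, ∀ t, γ t = η (t + c) := by
  obtain ⟨a, b, ha, hb, hab⟩ := h1
  obtain ⟨a', b', ha', hb', hab'⟩ := h2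
  have hpos : ∀ t, a ≤ t → γ t = η (t + (b - a)) := fun t ht => by
    have := hab (t - a) (by linarith)
    rw [add_sub_cancel] at this
    rw [this]; congr 1; ring
  have hneg : ∀ t, t ≤ -a' → γ t = η (t + (a' - b')) := fun t ht => by
    have := hab' (-t - a') (by linarith)
    simp only [add_sub_cancel, neg_neg] at this
    rw [this]; congr 1; ring
  have hcc : a' - b' = b - a := by
    have h1 := hγ.dist_line (a + |a' - b' - (b - a)|) (-a')
    have h2 := abs_nonneg (a' - b' - (b - a))
    rw [hpos _ (by linarith), hneg _ le_rfl, hη.dist_line,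
      abs_of_nonneg (show 0 ≤ a + |a' - b' - (b - a)| - -a' by linarith)] at h1
    have h3 := le_abs_self (a' - b' - (b - a))
    rcases abs_cases (a + |a' - b' - (b - a)| + (b - a) - (-a' + (a' - b'))) with
      ⟨e, _⟩ | ⟨e, _⟩ <;> rw [e] at h1 <;> linarith
  refine ⟨b - a, fun t => ?_⟩
  rw [hcc] at hneg
  exact h4.eq_of_eq_endpoints (γ := γ) (δ := fun t => η (t + (b - a))) (a := min (-a') t)
    (b := max a t) (fun _ _ _ _ => hγ.dist_line _ _)
    (fun _ _ _ _ => (hη.comp_add_real _).dist_line _ _)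
    (hneg _ (min_le_left _ _)) (hpos _ (le_max_left _ _)) ⟨min_le_right _ _, le_max_right _ _⟩

theorem RayMap.exists_line (h4 : FourPoint X) (hg : GeodesicPoints X) {γ δ : ℝ → X}
    (hγ : RayMap γ) (hδ : RayMap δ) (h : ¬ Asymptotic γ δ) :
    ∃ η : ℝ → X, Isometry η ∧ Asymptotic η γ ∧ Asymptotic (fun t => η (-t)) δ := by
  obtain ⟨δ', hδ', h0, hδδ'⟩ := hδ.exists_asymptotic_from h4 hg (γ 0)
  obtain ⟨T, hT, hTeq, hdist⟩ := hγ.exists_divergence h4 hδ' h0.symm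
    fun hh => h (hh.trans hδδ')
  refine ⟨_, isometry_glue (hγ.shift hT) (hδ'.shift hT) fun u v hu hv => ?_, ?_, ?_⟩
  · rw [hdist _ _ (by linarith) (by linarith)]; ring
  · refine ⟨0, T, le_rfl, hT, fun t ht => ?_⟩
    rw [zero_add]
    exact if_pos ht
  · refine Asymptotic.trans ⟨0, T, le_rfl, hT, fun t ht => ?_⟩ hδδ'
    rcases ht.eq_or_lt with rfl | ht
    · simp [hTeq]
    · simp [not_le.2 ht]

theorem IsometryEquiv.pow_apply_eq_of_fixed {k : X ≃ᵢ X} {y : X} (hy : k y = y) (n : ℕ) :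
    (k ^ n) y = y := by
  induction n with
  | zero => rfl
  | succ n ih => rw [pow_succ, IsometryEquiv.mul_apply, hy, ih]

theorem IsometryEquiv.pow_apply_line {k : X ≃ᵢ X} {γ : ℝ → X} {ℓ : ℝ}
    (h : ∀ t, k (γ t) = γ (t + ℓ)) (n : ℕ) (t : ℝ) : (k ^ n) (γ t) = γ (t + n * ℓ) := by
  induction n generalizing t with
  | zero => simp
  | succ n ih =>
    rw [pow_succ, IsometryEquiv.mul_apply, h, ih]
    congr 1; push_cast; ring

/-- The midpoint of `x` and `h x` lies on an axis of `h` unless it is fixed by `h`. -/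
theorem FourPoint.exists_axis (h4 : FourPoint X) (hg : GeodesicPoints X) (h : X ≃ᵢ X) {x m : X}
    (hm1 : dist x m = dist x (h x) / 2) (hm2 : dist m (h x) = dist x (h x) / 2)
    (hne : h m ≠ m) :
    ∃ (γ : ℝ → X) (ℓ : ℝ), 0 < ℓ ∧ Isometry γ ∧ ∀ t, h (γ t) = γ (t + ℓ) := by
  set D := dist x (h x) with hD
  set ℓ := dist m (h m) with hℓ
  have hℓ0 : 0 < ℓ := dist_pos.2 hne.symm
  have a1 : dist (h x) (h m) = D / 2 := by rw [h.dist_eq, hm1]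
  have a2 : dist (h m) (h (h x)) = D / 2 := by rw [h.dist_eq, hm2]
  have a3 : dist (h x) (h (h x)) = D := h.dist_eq _ _
  have a4 : dist (h m) (h (h m)) = ℓ := h.dist_eq _ _
  have a5 : dist (h (h x)) (h (h m)) = D / 2 := by rw [h.dist_eq, a1]
  have b1 : ℓ + D / 2 ≤ dist m (h (h x)) := by
    have c1 := dist_comm (h m) (h x)
    rcases le_max_iff.1 (h4 m (h m) (h x) (h (h x))) with s | s <;> linarith
  have b2 : ℓ + D / 2 ≤ dist x (h m) := by
    have c1 := dist_comm (h m) x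
    have c2 := dist_comm (h m) (h x)
    have c3 := dist_comm m x
    rcases le_max_iff.1 (h4 m (h m) x (h x)) with s | s <;> linarith
  have b3 : dist (h x) (h (h m)) = dist x (h m) := h.dist_eq _ _
  have b4 : 2 * ℓ ≤ dist m (h (h m)) := by
    have c1 := dist_comm (h (h x)) (h m)
    rcases le_max_iff.1 (h4 m (h (h x)) (h m) (h (h m))) with s | s <;> linarith
  have b5 : dist m (h (h m)) = 2 * ℓ :=
    le_antisymm (by linarith [dist_triangle m (h m) (h (h m))]) b4
  have hpow : ∀ n : ℕ, dist m ((h ^ n) m) = n * ℓ ∧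
      dist m ((h ^ (n + 1)) m) = (n + 1 : ℕ) * ℓ := by
    intro n
    induction n with
    | zero => simp [← hℓ]
    | succ n ih =>
      refine ⟨ih.2, ?_⟩
      have e1 : dist ((h ^ n) m) ((h ^ (n + 1)) m) = ℓ := by
        rw [pow_succ, IsometryEquiv.mul_apply, (h ^ n).dist_eq]
      have e2 : dist ((h ^ (n + 1)) m) ((h ^ (n + 1 + 1)) m) = ℓ := by
        rw [pow_succ _ (n + 1), IsometryEquiv.mul_apply, (h ^ (n + 1)).dist_eq]
      have e3 : dist ((h ^ n) m) ((h ^ (n + 1 + 1)) m) = 2 * ℓ := by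
        rw [pow_succ, pow_succ, IsometryEquiv.mul_apply, IsometryEquiv.mul_apply,
          (h ^ n).dist_eq, b5]
      have t1 := dist_triangle m ((h ^ (n + 1)) m) ((h ^ (n + 1 + 1)) m)
      have c1 := dist_comm ((h ^ n) m) ((h ^ (n + 1)) m)
      have ih1 := ih.1
      have ih2 := ih.2
      push_cast at ih2 ⊢
      rcases le_max_iff.1 (h4 m ((h ^ (n + 1)) m) ((h ^ n) m) ((h ^ (n + 1 + 1)) m)) with s | s <;>
      linarith
  have hp : ∀ i j : ℤ, dist ((h ^ i) m) ((h ^ j) m) = |i * ℓ - j * ℓ| := by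
    have aux : ∀ (i : ℤ) (n : ℕ), dist ((h ^ i) m) ((h ^ (i + n)) m) = n * ℓ := by
      intro i n
      rw [zpow_add, IsometryEquiv.mul_apply, (h ^ i).dist_eq, zpow_natCast, (hpow n).1]
    intro i j
    rcases le_total i j with hij | hij
    · obtain ⟨n, rfl⟩ := Int.le.dest hij
      rw [aux]
      push_cast
      rw [abs_of_nonpos (by nlinarith [n.cast_nonneg (α := ℝ)])]
      ring
    · obtain ⟨n, rfl⟩ := Int.le.dest hij
      rw [dist_comm, aux]
      push_cast
      rw [abs_of_nonneg (by nlinarith [n.cast_nonneg (α := ℝ)])]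
      ring
  have hfl : ∀ t : ℝ, (⌊t / ℓ⌋ : ℝ) * ℓ ≤ t := fun t =>
    (le_div_iff₀ hℓ0).1 (Int.floor_le _)
  have hce : ∀ t : ℝ, t ≤ (⌈t / ℓ⌉ : ℝ) * ℓ := fun t =>
    (div_le_iff₀ hℓ0).1 (Int.le_ceil _)
  obtain ⟨γ, hγ, hγp⟩ := h4.exists_isometric_extension hg (p := fun i : ℤ => (h ^ i) m)
    (c := fun i : ℤ => i * ℓ) hp Set.univ fun t _ => ⟨⌊t / ℓ⌋, ⌈t / ℓ⌉, hfl t, hce t⟩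
  have hγ' : Isometry γ := Isometry.of_dist_eq fun s t =>
    (hγ s trivial t trivial).trans (Real.dist_eq s t).symm
  have hstep : ∀ i : ℤ, h (γ (i * ℓ)) = γ (i * ℓ + ℓ) := by
    intro i
    have e1 := hγp i trivial
    have e2 := hγp (i + 1) trivial
    rw [e1, ← IsometryEquiv.mul_apply, ← zpow_one_add, add_comm 1 i, ← e2]
    congr 1; push_cast; ring
  refine ⟨γ, ℓ, hℓ0, hγ', fun t => ?_⟩
  exact h4.eq_of_eq_endpoints (γ := h ∘ γ) (δ := fun t => γ (t + ℓ))
    (fun _ _ _ _ => (h.isometry.comp hγ').dist_line _ _)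
    (fun _ _ _ _ => (hγ'.comp_add_real _).dist_line _ _)
    (hstep ⌊t / ℓ⌋) (hstep ⌈t / ℓ⌉) ⟨hfl t, hce t⟩

theorem not_bounded_of_axis {k : X ≃ᵢ X} {γ : ℝ → X} {ℓ : ℝ} (hℓ : 0 < ℓ) (hγ : Isometry γ)
    (h : ∀ t, k (γ t) = γ (t + ℓ)) (y : X) (C : ℝ) : ∃ n : ℕ, C < dist ((k ^ n) y) y := by
  obtain ⟨n, hn⟩ := exists_nat_gt ((C + 2 * dist y (γ 0)) / ℓ)
  refine ⟨n, ?_⟩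
  have h1 := IsometryEquiv.pow_apply_line h n 0
  have h2 := hγ.dist_line (0 + n * ℓ) 0
  rw [← h1, zero_add, sub_zero, abs_of_nonneg (by positivity)] at h2
  have h3 := dist_triangle4 ((k ^ n) (γ 0)) ((k ^ n) y) y (γ 0)
  rw [(k ^ n).dist_eq, dist_comm (γ 0) y] at h3
  rw [div_lt_iff₀ hℓ] at hn
  linarith

theorem GeodesicPoints.exists_midpoint (hg : GeodesicPoints X) (x y : X) :
    ∃ m, dist x m = dist x y / 2 ∧ dist m y = dist x y / 2 := by
  obtain ⟨m, h1, h2⟩ := hg x y (dist x y / 2) (by linarith [dist_nonneg (x := x) (y := y)])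
    (by linarith [dist_nonneg (x := x) (y := y)])
  exact ⟨m, h1, by linarith⟩

theorem FourPoint.midpoint_fixed (h4 : FourPoint X) (hg : GeodesicPoints X) {k : X ≃ᵢ X}
    (hk : ∃ y, k y = y) {x m : X} (hm1 : dist x m = dist x (k x) / 2)
    (hm2 : dist m (k x) = dist x (k x) / 2) : k m = m := by
  by_contra hne
  obtain ⟨y, hy⟩ := hk
  obtain ⟨γ, ℓ, hℓ, hγ, h⟩ := h4.exists_axis hg k hm1 hm2 hne
  obtain ⟨n, hn⟩ := not_bounded_of_axis hℓ hγ h y 0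
  rw [IsometryEquiv.pow_apply_eq_of_fixed hy, dist_self] at hn
  exact lt_irrefl _ hn

theorem FourPoint.exists_fixed_or_axis (h4 : FourPoint X) (hg : GeodesicPoints X) [Nonempty X]
    (k : X ≃ᵢ X) : (∃ y, k y = y) ∨
      ∃ (γ : ℝ → X) (ℓ : ℝ), 0 < ℓ ∧ Isometry γ ∧ ∀ t, k (γ t) = γ (t + ℓ) := by
  obtain ⟨x⟩ := ‹Nonempty X›
  obtain ⟨m, h1, h2⟩ := hg.exists_midpoint x (k x)
  by_cases hm : k m = m
  · exact Or.inl ⟨m, hm⟩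
  · exact Or.inr (h4.exists_axis hg k h1 h2 hm)

theorem BoundedSubgroup.exists_fixed (h4 : FourPoint X) (hg : GeodesicPoints X)
    {H : Subgroup (X ≃ᵢ X)} (hH : BoundedSubgroup H) {k : X ≃ᵢ X} (hk : k ∈ H) :
    ∃ y, k y = y := by
  obtain ⟨x, C, hC⟩ := hH
  have : Nonempty X := ⟨x⟩
  refine (h4.exists_fixed_or_axis hg k).resolve_right ?_
  rintro ⟨γ, ℓ, hℓ, hγ, h⟩
  obtain ⟨n, hn⟩ := not_bounded_of_axis hℓ hγ h x C
  exact absurd (hC _ (H.pow_mem hk n)) (not_le.2 hn)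

/-- Serre's lemma: if `k`, `l` and `k * l` are elliptic then `k` and `l` have a common fixed
point. -/
theorem FourPoint.exists_common_fixed (h4 : FourPoint X) (hg : GeodesicPoints X) {k l : X ≃ᵢ X}
    (hk : ∃ y, k y = y) (hl : ∃ y, l y = y) (hkl : ∃ y, (k * l) y = y) :
    ∃ y, k y = y ∧ l y = y := by
  obtain ⟨b, hb⟩ := hl
  obtain ⟨m, h1, h2⟩ := hg.exists_midpoint b (k b)
  have hkm := h4.midpoint_fixed hg hk h1 h2
  have hklb : (k * l) b = k b := by rw [IsometryEquiv.mul_apply, hb]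
  have hklm := h4.midpoint_fixed hg hkl (x := b) (m := m) (by rw [hklb, h1]) (by rw [hklb, h2])
  refine ⟨m, hkm, k.injective ?_⟩
  rw [← IsometryEquiv.mul_apply, hklm, hkm]

theorem dist_add_dist_of_fixed (h4 : FourPoint X) {k : X ≃ᵢ X} {x m y : X} (hy : k y = y)
    (hm1 : dist x m = dist x (k x) / 2) (hm2 : dist m (k x) = dist x (k x) / 2) :
    dist x m + dist m y = dist x y := by
  have h1 : dist (k x) y = dist x y := by
    conv_lhs => rw [← hy]
    exact k.dist_eq _ _
  have h2 := dist_triangle x m y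
  have h3 := dist_comm m (k x)
  rcases le_max_iff.1 (h4 x (k x) m y) with s | s <;> linarith

theorem FourPoint.fixed_of_between (h4 : FourPoint X) {k : X ≃ᵢ X} {x y z : X} (hx : k x = x)
    (hy : k y = y) (hz : dist x z + dist z y = dist x y) : k z = z := by
  refine (h4.eq_of_between hz ?_ ?_).symm
  · conv_rhs => rw [← hx]
    exact (k.dist_eq _ _).symm
  · conv_rhs => rw [← hy]
    exact (k.dist_eq _ _).symm

/-- An unbounded group of elliptic isometries fixes an end. -/
theorem exists_fixed_end_of_elliptic (h4 : FourPoint X) (hg : GeodesicPoints X) (x : X)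
    {K : Subgroup (X ≃ᵢ X)} (hell : ∀ k ∈ K, ∃ y, k y = y) (hK : ¬ BoundedSubgroup K) :
    ∃ e : Set (Set X), IsEnd e ∧ ∀ k ∈ K, pushEnd k e = e := by
  choose m hm1 hm2 using fun k : K => hg.exists_midpoint x (k.1 x)
  have hbetw : ∀ (k : K) (y : X), k.1 y = y → dist x (m k) + dist (m k) y = dist x y :=
    fun k y hy => dist_add_dist_of_fixed h4 hy (hm1 k) (hm2 k)
  have hmfix : ∀ k : K, k.1 (m k) = m k := fun k =>
    h4.midpoint_fixed hg (hell k k.2) (hm1 k) (hm2 k)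
  have hcommon : ∀ k l : K, ∃ y, k.1 y = y ∧ l.1 y = y := fun k l =>
    h4.exists_common_fixed hg (hell k k.2) (hell l l.2) (hell _ (K.mul_mem k.2 l.2))
  have haux : ∀ k l : K, dist x (m k) ≤ dist x (m l) →
      dist (m k) (m l) = dist x (m l) - dist x (m k) ∧ k.1 (m l) = m l := by
    intro k l hkl
    obtain ⟨y, hyk, hyl⟩ := hcommon k l
    have e1 := hbetw k y hyk
    have e2 := hbetw l y hyl
    have t1 := dist_triangle x (m k) (m l)
    have c1 := dist_comm y (m k)
    have c2 := dist_comm y (m l)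
    have e3 : dist (m k) (m l) = dist x (m l) - dist x (m k) := by
      rcases le_max_iff.1 (h4 x y (m k) (m l)) with s | s <;> linarith
    exact ⟨e3, h4.fixed_of_between (hmfix k) hyk (by linarith)⟩
  have hp : ∀ k l : K, dist (m k) (m l) = |dist x (m k) - dist x (m l)| := by
    intro k l
    rcases le_total (dist x (m k)) (dist x (m l)) with h | h
    · rw [(haux k l h).1, abs_of_nonpos (by linarith)]; ring
    · rw [dist_comm, (haux l k h).1, abs_of_nonneg (by linarith)]
  have hunb : ∀ C, ∃ k : K, C < dist x (m k) := by
    intro C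
    by_contra! hC
    refine hK ⟨x, 2 * C, fun k hk => ?_⟩
    have := hC ⟨k, hk⟩
    rw [hm1] at this
    rw [dist_comm]
    linarith
  have h1 : dist x (m 1) = 0 := by simp [hm1]
  obtain ⟨ρ, hρ, hρm⟩ := h4.exists_isometric_extension hg (p := m)
    (c := fun k => dist x (m k)) hp (Set.Ici 0) fun t ht => by
      obtain ⟨k, hk⟩ := hunb t
      exact ⟨1, k, h1.le.trans ht, hk.le⟩
  refine ⟨endOf ρ, RayMap.isEnd hρ, fun k hk => ?_⟩
  rw [RayMap.pushEnd_endOf_eq_iff h4 hρ hρ]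
  have hfix : ∀ l : K, dist x (m ⟨k, hk⟩) ≤ dist x (m l) →
      (k ∘ ρ) (dist x (m l)) = ρ (dist x (m l)) := fun l hl => by
    rw [Function.comp_apply, hρm l dist_nonneg]
    exact (haux ⟨k, hk⟩ l hl).2
  refine ⟨dist x (m ⟨k, hk⟩), dist x (m ⟨k, hk⟩), dist_nonneg, dist_nonneg, fun t ht => ?_⟩
  obtain ⟨l, hl⟩ := hunb (dist x (m ⟨k, hk⟩) + t)
  exact h4.eq_of_eq_endpoints ((RayMap.comp hρ k).mono dist_nonneg) (RayMap.mono hρ dist_nonneg)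
    (hfix _ le_rfl) (hfix l (by linarith)) ⟨by linarith, hl.le⟩

/-- An elliptic isometry fixing the end of a ray fixes the part of the ray beyond the
displacement of its origin. -/
theorem RayMap.fixed_of_asymptotic (h4 : FourPoint X) {γ : ℝ → X} (hγ : RayMap γ) {k : X ≃ᵢ X}
    (hell : ∃ y, k y = y) (hk : Asymptotic (k ∘ γ) γ) {t : ℝ} (ht : dist (k (γ 0)) (γ 0) ≤ t) :
    k (γ t) = γ t := by
  obtain ⟨a, b, ha, hb, hab⟩ := hk
  obtain ⟨y, hy⟩ := hell
  have hky : ∀ z, dist y (k z) = dist y z := fun z => by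
    conv_lhs => rw [← hy]
    exact k.dist_eq _ _
  obtain rfl : a = b := by
    have h1 := hγ.dist_apply_eq h4 y (t := a + dist y (γ 0)) (by linarith)
    have h2 := hγ.dist_apply_eq h4 y (t := b + dist y (γ 0)) (by linarith)
    have h3 := hab (dist y (γ 0)) dist_nonneg
    rw [Function.comp_apply] at h3
    rw [← hky, h3] at h1
    linarith
  have ht0 : 0 ≤ t := dist_nonneg.trans ht
  have hfar : k (γ (a + t)) = γ (a + t) := hab t ht0
  have h1 := hγ.dist_apply_eq h4 (k (γ 0)) ht
  have h2 := hγ.dist_apply_eq h4 (k (γ 0)) (t := a + t) (by linarith)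
  have h3 := hγ.dist_of_le le_rfl (show 0 ≤ a + t by linarith)
  have h5 := hγ.dist_of_le le_rfl ht0
  have h6 := hγ.dist_of_le ht0 (show t ≤ a + t by linarith)
  have h7 : dist (k (γ 0)) (γ (a + t)) = a + t - 0 := by rw [← hfar, k.dist_eq, h3]
  have h8 : dist (k (γ t)) (γ (a + t)) = a + t - t := by
    conv_lhs => rw [← hfar]
    rw [k.dist_eq, h6]
  refine h4.eq_of_between (x := k (γ 0)) (y := γ (a + t)) ?_ ?_ ?_
  · rw [k.dist_eq, h5, h7, h8]; ring
  · rw [k.dist_eq]; linarith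
  · rw [h8, h6]

/-- The action of `G` on ends is transitive on ordered pairs of distinct ends. -/
def TwoTransitiveOnEnds (G : Subgroup (X ≃ᵢ X)) : Prop :=
  ∀ a b a' b' : Set (Set X), IsEnd a → IsEnd b → IsEnd a' → IsEnd b' →
    a ≠ b → a' ≠ b' → ∃ g ∈ G, pushEnd (⇑g) a = a' ∧ pushEnd (⇑g) b = b'

theorem Isometry.endOf_ne (h4 : FourPoint X) {γ : ℝ → X} (hγ : Isometry γ) :
    endOf γ ≠ endOf fun t => γ (-t) := fun h =>
  hγ.not_asymptotic_neg ((RayMap.endOf_eq_iff h4 hγ.rayMap hγ.comp_neg_real.rayMap).1 h)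

/-- The isometries fixing a point. -/
def isometryStabilizer (q : X) : Subgroup (X ≃ᵢ X) where
  carrier := {k | k q = q}
  one_mem' := rfl
  mul_mem' := fun {a b} (ha : a q = q) (hb : b q = q) =>
    show (a * b) q = q by rw [IsometryEquiv.mul_apply, hb, ha]
  inv_mem' := fun {a} (ha : a q = q) =>
    show a⁻¹ q = q by
      conv_lhs => rw [← ha]
      exact IsometryEquiv.inv_apply_self a q

namespace TwoTransitiveOnEnds

variable {G : Subgroup (X ≃ᵢ X)}

theorem exists_map_line (hG : TwoTransitiveOnEnds G) (h4 : FourPoint X) {γ η : ℝ → X}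
    (hγ : Isometry γ) (hη : Isometry η) : ∃ g ∈ G, ∃ c, ∀ t, g (γ t) = η (t + c) := by
  obtain ⟨g, hg, h1, h2⟩ := hG _ _ _ _ hγ.rayMap.isEnd hγ.comp_neg_real.rayMap.isEnd
    hη.rayMap.isEnd hη.comp_neg_real.rayMap.isEnd (hγ.endOf_ne h4) (hη.endOf_ne h4)
  rw [RayMap.pushEnd_endOf_eq_iff h4 hγ.rayMap hη.rayMap] at h1
  rw [RayMap.pushEnd_endOf_eq_iff h4 hγ.comp_neg_real.rayMap hη.comp_neg_real.rayMap] at h2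
  exact ⟨g, hg, Isometry.eq_shift_of_asymptotic h4 (g.isometry.comp hγ) hη h1 h2⟩

/-- If `G` contains a hyperbolic isometry, then every line is reversed by elements of `G` whose
centers on the line are arbitrarily far. -/
theorem exists_reversal (hG : TwoTransitiveOnEnds G) (h4 : FourPoint X) (hg : GeodesicPoints X)
    [Nonempty X] (hhyp : ∃ k ∈ G, ¬ ∃ y, k y = y) {η : ℝ → X} (hη : Isometry η) (T : ℝ) :
    ∃ s ∈ G, ∃ c, T ≤ c ∧ ∀ t, s (η t) = η (2 * c - t) := by
  obtain ⟨k, hkG, hk⟩ := hhyp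
  obtain ⟨γ, ℓ, hℓ, hγ, hkγ⟩ := (h4.exists_fixed_or_axis hg k).resolve_left hk
  obtain ⟨g, hgG, c, hgγ⟩ := hG.exists_map_line h4 hγ hη
  obtain ⟨s, hsG, d, hs⟩ := hG.exists_map_line h4 hη hη.comp_neg_real
  have hinv : ∀ t, g⁻¹ (η t) = γ (t - c) := fun t => by
    have h := congrArg (⇑g⁻¹) (hgγ (t - c))
    rwa [IsometryEquiv.inv_apply_self, sub_add_cancel, eq_comm] at h
  have htrans : ∀ t, (g * k * g⁻¹) (η t) = η (t + ℓ) := fun t => by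
    rw [IsometryEquiv.mul_apply, IsometryEquiv.mul_apply, hinv, hkγ, hgγ]
    congr 1; ring
  obtain ⟨n, hn⟩ := exists_nat_gt ((2 * T + d) / ℓ)
  rw [div_lt_iff₀ hℓ] at hn
  refine ⟨(g * k * g⁻¹) ^ n * s, G.mul_mem (G.pow_mem (G.mul_mem (G.mul_mem hgG hkG)
    (G.inv_mem hgG)) n) hsG, (n * ℓ - d) / 2, by linarith, fun t => ?_⟩
  rw [IsometryEquiv.mul_apply, hs, IsometryEquiv.pow_apply_line htrans]
  congr 1; ring

/-- If `s ∈ G` fixes `q` and reverses a line through `q`, then the stabilizer of `q` in `G`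
fixes no end. -/
theorem stabilizer_no_fixed_end (hG : TwoTransitiveOnEnds G) (h4 : FourPoint X)
    (hg : GeodesicPoints X) [Nonempty X] (hhyp : ∃ k ∈ G, ¬ ∃ y, k y = y) {γ : ℝ → X}
    (hγ : Isometry γ) {s : X ≃ᵢ X} (hsG : s ∈ G) {c : ℝ} (hs : ∀ t, s (γ t) = γ (2 * c - t))
    {e : Set (Set X)} (he : IsEnd e) (hfix : ∀ k ∈ G, k (γ c) = γ c → pushEnd k e = e) :
    False := by
  obtain ⟨δ₀, hδ₀, rfl⟩ := he.exists_rayMap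
  obtain ⟨δ, hδ, hδq, hδδ₀⟩ := hδ₀.exists_asymptotic_from h4 hg (γ c)
  rw [← (hδ.endOf_eq_iff h4 hδ₀).2 hδδ₀] at hfix
  have hkδ : ∀ k ∈ G, k (γ c) = γ c → ∀ t, 0 ≤ t → k (δ t) = δ t := fun k hk hkq t ht =>
    RayMap.eq_of_asymptotic h4 (hδ.comp k) hδ (by rw [Function.comp_apply, hδq, hkq])
      ((hδ.pushEnd_endOf_eq_iff h4 hδ k).1 (hfix k hk hkq)) ht
  have hsq : s (γ c) = γ c := by rw [hs]; congr 1; ring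
  set α : ℝ → X := fun t => γ (t + c) with hα
  have hαi : Isometry α := hγ.comp_add_real c
  have hsα : ∀ t, s (α t) = α (-t) := fun t => by
    simp only [hα, hs]; congr 1; ring
  have hsα' : ∀ t, 0 < t → s (α t) ≠ α t := fun t ht h => by
    rw [hsα] at h
    linarith [hαi.injective h]
  have hα0 : δ 0 = α 0 := by simp [hα, hδq]
  have hnot : ¬ Asymptotic δ α := fun h => by
    have h1 := hδ.eq_of_asymptotic h4 hαi.rayMap hα0 h zero_le_one
    exact hsα' 1 one_pos (by rw [← h1, hkδ s hsG hsq 1 zero_le_one])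
  obtain ⟨T, hT, hTeq, hdist⟩ := hδ.exists_divergence h4 hαi.rayMap hα0 hnot
  obtain rfl : T = 0 := by
    by_contra hne
    exact hsα' T (lt_of_le_of_ne hT (Ne.symm hne)) (by rw [← hTeq, hkδ s hsG hsq T hT])
  have hη := isometry_glue hδ hαi.rayMap fun u v hu hv => by rw [hdist u v hu hv]; ring
  set η : ℝ → X := fun t => if 0 ≤ t then δ t else α (-t) with hηdef
  have hηpos : ∀ t, 0 ≤ t → η t = δ t := fun t ht => if_pos ht
  have hηneg : ∀ t, t < 0 → η t = α (-t) := fun t ht => if_neg (not_le.2 ht)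
  obtain ⟨r, hrG, c', hc', hr⟩ := hG.exists_reversal h4 hg hhyp hη 0
  have hq : r (γ c) = δ (2 * c') := by
    rw [← hδq, ← hηpos 0 le_rfl, hr, sub_zero, hηpos _ (by linarith)]
  have hconj : (r⁻¹ * s * r) (γ c) = γ c := by
    rw [IsometryEquiv.mul_apply, IsometryEquiv.mul_apply, hq, hkδ s hsG hsq _ (by linarith), ← hq,
      IsometryEquiv.inv_apply_self]
  have h1 := hkδ _ (G.mul_mem (G.mul_mem (G.inv_mem hrG) hsG) hrG) hconj (2 * c' + 1)
    (by linarith)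
  rw [IsometryEquiv.mul_apply, IsometryEquiv.mul_apply] at h1
  replace h1 := congrArg r h1
  rw [IsometryEquiv.apply_inv_self, ← hηpos _ (by linarith), hr, hηneg _ (by linarith)] at h1
  exact hsα' _ (by linarith) h1

end TwoTransitiveOnEnds

end RTree

theorem bounded_iff_elliptic_no_fixed_end {X : Type*} [MetricSpace X]
    (htree : IsRTree X) (hleaf : Leafless X) (hlf : LocallyFiniteTree X)
    (hends : AtLeastThreeEnds X) (hinf : {e : Set (Set X) | IsEnd e}.Infinite)
    (G : Subgroup (X ≃ᵢ X))
    (h2trans : ∀ a b a' b' : Set (Set X), IsEnd a → IsEnd b → IsEnd a' → IsEnd b' →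
      a ≠ b → a' ≠ b' → ∃ g ∈ G, pushEnd (⇑g) a = a' ∧ pushEnd (⇑g) b = b')
    (H : Subgroup (X ≃ᵢ X)) (hHG : H ≤ G) :
    BoundedSubgroup H ↔
      ∃ K : Subgroup (X ≃ᵢ X), K ≤ G ∧ H ≤ K ∧
        (∀ k ∈ K, ∃ x : X, k x = x) ∧
        ¬ ∃ e : Set (Set X), IsEnd e ∧ ∀ k ∈ K, pushEnd (⇑k) e = e := by
  have h4 := htree.fourPoint
  have hg := htree.geodesicPoints
  have hG : TwoTransitiveOnEnds G := h2trans
  obtain ⟨e₁, e₂, -, he₁, he₂, -, he₁₂, -, -⟩ := hends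
  have hother : ∀ e, ∃ a : Set (Set X), IsEnd a ∧ a ≠ e := fun e => by
    by_cases h : e₁ = e
    · exact ⟨e₂, he₂, fun h' => he₁₂ (h.trans h'.symm)⟩
    · exact ⟨e₁, he₁, h⟩
  constructor
  · intro hH
    obtain ⟨x₀, C, hC⟩ := id hH
    have hX : Nonempty X := ⟨x₀⟩
    by_cases hfix : ∃ e : Set (Set X), IsEnd e ∧ ∀ k ∈ H, pushEnd (⇑k) e = e
    swap
    · exact ⟨H, hHG, le_rfl, fun k hk => hH.exists_fixed h4 hg hk, hfix⟩
    by_cases hhyp : ∃ k ∈ G, ¬ ∃ y, k y = y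
    swap
    · push Not at hhyp
      refine ⟨G, le_rfl, hHG, hhyp, ?_⟩
      rintro ⟨e, he, hGe⟩
      obtain ⟨a, ha, hae⟩ := hother e
      obtain ⟨g, hgG, h1, -⟩ := h2trans e a a e he ha ha he hae.symm hae
      exact hae (h1.symm.trans (hGe g hgG))
    obtain ⟨e, he, hHe⟩ := hfix
    obtain ⟨a, ha, hae⟩ := hother e
    obtain ⟨γ₀, hγ₀, rfl⟩ := he.exists_rayMap
    obtain ⟨δ₀, hδ₀, rfl⟩ := ha.exists_rayMap
    obtain ⟨γ, hγ, hγγ₀, -⟩ := hγ₀.exists_line h4 hg hδ₀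
      fun h => hae ((hγ₀.endOf_eq_iff h4 hδ₀).2 h).symm
    rw [← (hγ.rayMap.endOf_eq_iff h4 hγ₀).2 hγγ₀] at hHe
    obtain ⟨s, hsG, c, hc, hs⟩ := hG.exists_reversal h4 hg hhyp hγ (C + 2 * dist x₀ (γ 0))
    refine ⟨G ⊓ isometryStabilizer (γ c), inf_le_left, ?_, ?_, ?_⟩
    · refine le_inf hHG fun k hk => ?_
      refine hγ.rayMap.fixed_of_asymptotic h4 (hH.exists_fixed h4 hg hk)
        ((hγ.rayMap.pushEnd_endOf_eq_iff h4 hγ.rayMap k).1 (hHe k hk)) ?_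
      have h1 := dist_triangle4 (k (γ 0)) (k x₀) x₀ (γ 0)
      rw [k.dist_eq, dist_comm (γ 0) x₀] at h1
      linarith [hC k hk]
    · exact fun k hk => ⟨γ c, hk.2⟩
    · rintro ⟨e', he', hfix'⟩
      exact hG.stabilizer_no_fixed_end h4 hg hhyp hγ hsG hs he'
        fun k hk hkq => hfix' k ⟨hk, hkq⟩
  · rintro ⟨K, -, hHK, hell, hno⟩
    obtain ⟨γ, -, -⟩ := he₁.exists_rayMap
    have hK : BoundedSubgroup K := by
      by_contra hK
      exact hno (exists_fixed_end_of_elliptic h4 hg (γ 0) hell hK)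
    obtain ⟨x, C, hC⟩ := hK
    exact ⟨x, C, fun h hh => hC h (hHK hh)⟩
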